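/- Let (X,≤) be a well quasi order, let S ⊆ D ⊆ X with D downward-closed, and let I be a maximal ideal of D. Then I ⊆ ↓S if and only if I is in the adherence of S. -/

import Mathlib

/-- `D` is downward-closed for the quasi-order `le`. -/
def DownClosed {X : Type*} (le : X → X → Prop) (D : Set X) : Prop :=
  ∀ ⦃x y : X⦄, le x y → y ∈ D → x ∈ D

/-- `U` is upward-closed for the quasi-order `le`. -/
def UpClosed {X : Type*} (le : X → X → Prop) (U : Set X) : Prop :=
  ∀ ⦃x y : X⦄, le x y → x ∈ U → y ∈ U

/-- `S` is directed for the quasi-order `le`. -/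
def DirectedSet {X : Type*} (le : X → X → Prop) (S : Set X) : Prop :=
  ∀ x₁ ∈ S, ∀ x₂ ∈ S, ∃ x ∈ S, le x₁ x ∧ le x₂ x

/-- An ideal: a nonempty, downward-closed, directed subset. -/
def IsIdealSet {X : Type*} (le : X → X → Prop) (I : Set X) : Prop :=
  I.Nonempty ∧ DownClosed le I ∧ DirectedSet le I

/-- Downward closure `↓S`. -/
def DownCl {X : Type*} (le : X → X → Prop) (S : Set X) : Set X :=
  {x | ∃ s ∈ S, le x s}

/-- Upward closure `↑S`. -/
def UpCl {X : Type*} (le : X → X → Prop) (S : Set X) : Set X :=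
  {x | ∃ s ∈ S, le s x}

/-- A well quasi order: a reflexive transitive relation such that every infinite
sequence is good (some `f i ≤ f j` with `i < j`). -/
def IsWqo {X : Type*} (le : X → X → Prop) : Prop :=
  Reflexive le ∧ Transitive le ∧ ∀ f : ℕ → X, ∃ i j : ℕ, i < j ∧ le (f i) (f j)

/-- In a wqo, strict inclusion of downward-closed sets is well-founded. -/
theorem IsWqo.wellFounded_downClosed {X : Type*} {le : X → X → Prop} (hwqo : IsWqo le) :
    WellFounded fun A B : {E : Set X // DownClosed le E} => A.1 ⊂ B.1 := by
  rw [wellFounded_iff_isEmpty_descending_chain]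
  refine ⟨fun ⟨E, hE⟩ => ?_⟩
  have hanti : Antitone fun n => (E n).1 := antitone_nat_of_succ_le fun n => (hE n).1
  choose x hx hx' using fun n => Set.exists_of_ssubset (hE n)
  obtain ⟨i, j, hij, hle⟩ := hwqo.2.2 x
  exact hx' i ((E (i + 1)).2 hle (hanti (Nat.succ_le_of_lt hij) (hx j)))

/-- A directed set covered by the downward closures of two sets is covered by one of them. -/
theorem DirectedSet.subset_downCl_or {X : Type*} {le : X → X → Prop} (htrans : Transitive le)
    {I A B : Set X} (hI : DirectedSet le I) (h : I ⊆ DownCl le (A ∪ B)) :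
    I ⊆ DownCl le A ∨ I ⊆ DownCl le B := by
  by_contra! hc
  obtain ⟨⟨a, ha, haA⟩, ⟨b, hb, hbB⟩⟩ := hc.imp Set.not_subset.1 Set.not_subset.1
  obtain ⟨c, hc, hac, hbc⟩ := hI a ha b hb
  obtain ⟨s, hs | hs, hcs⟩ := h hc
  · exact haA ⟨s, hs, htrans hac hcs⟩
  · exact hbB ⟨s, hs, htrans hbc hcs⟩

/-- A maximal ideal `I` of a downward-closed set `D` in a wqo is not covered by `↓(D \ I)`. -/
theorem IsWqo.not_subset_downCl_diff {X : Type*} {le : X → X → Prop} (hwqo : IsWqo le)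
    {D I : Set X} (hD : DownClosed le D) (hI : IsIdealSet le I)
    (hmax : ∀ J : Set X, IsIdealSet le J → J ⊆ D → I ⊆ J → J = I) :
    ¬ I ⊆ DownCl le (D \ I) := by
  intro hcov
  obtain ⟨⟨E, hE⟩, ⟨hED, hIE⟩, hmin⟩ := hwqo.wellFounded_downClosed.has_min
    {E | E.1 ⊆ D ∧ I ⊆ DownCl le (E.1 \ I)} ⟨⟨D, hD⟩, subset_rfl, hcov⟩
  have hsub : I ⊆ E := fun x hx => by
    obtain ⟨s, hs, hxs⟩ := hIE hx
    exact hE hxs hs.1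
  have hremove : ∀ x ∈ E, ¬ I ⊆ DownCl le ({y ∈ E | ¬ le x y} \ I) := fun x hx h =>
    hmin ⟨{y ∈ E | ¬ le x y}, fun _ _ hab hb =>
        ⟨hE hab hb.1, fun hxa => hb.2 (hwqo.2.1 hxa hab)⟩⟩
      ⟨fun _ hy => hED hy.1, h⟩
      ⟨fun _ hy => hy.1, fun h' => (h' hx).2 (hwqo.1 x)⟩
  have hdir : DirectedSet le E := by
    intro x hx y hy
    by_contra! hxy
    have hsplit : E \ I ⊆ ({z ∈ E | ¬ le x z} \ I) ∪ ({z ∈ E | ¬ le y z} \ I) := fun z hz => by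
      by_cases h : le x z
      · exact Or.inr ⟨⟨hz.1, hxy z hz.1 h⟩, hz.2⟩
      · exact Or.inl ⟨⟨hz.1, h⟩, hz.2⟩
    have hcov' : I ⊆ DownCl le (({z ∈ E | ¬ le x z} \ I) ∪ ({z ∈ E | ¬ le y z} \ I)) :=
      fun w hw => (hIE hw).imp fun _ h => ⟨hsplit h.1, h.2⟩
    exact (hI.2.2.subset_downCl_or hwqo.2.1 hcov').elim (hremove x hx) (hremove y hy)
  have hEI : E = I := hmax E ⟨hI.1.mono hsub, hE, hdir⟩ hED hsub
  obtain ⟨x, hx⟩ := hI.1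
  obtain ⟨s, hs, -⟩ := hIE hx
  exact hs.2 (hEI ▸ hs.1)

/-- Let `(X, le)` be a wqo, `S ⊆ D ⊆ X` with `D` downward-closed, and `I` a
maximal ideal of `D`.  Then `I ⊆ ↓S` iff `I` is in the adherence of `S`, i.e.
iff `I` is the downward closure of some directed subset of `S`. -/
theorem maximal_ideal_adherence_iff {X : Type*} (le : X → X → Prop)
    (hwqo : IsWqo le) (S D : Set X) (hSD : S ⊆ D) (hD : DownClosed le D)
    (I : Set X) (hI : IsIdealSet le I) (hID : I ⊆ D)
    (hmax : ∀ J : Set X, IsIdealSet le J → J ⊆ D → I ⊆ J → J = I) :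
    I ⊆ DownCl le S ↔ ∃ Δ : Set X, Δ ⊆ S ∧ DirectedSet le Δ ∧ DownCl le Δ = I := by
  constructor
  · intro hIS
    obtain ⟨w, hw, hwD⟩ := Set.not_subset.1 (hwqo.not_subset_downCl_diff hD hI hmax)
    have hcofinal : ∀ x ∈ I, ∃ s ∈ S ∩ I, le x s := fun x hx => by
      obtain ⟨z, hz, hxz, hwz⟩ := hI.2.2 x hx w hw
      obtain ⟨s, hs, hzs⟩ := hIS hz
      refine ⟨s, ⟨hs, ?_⟩, hwqo.2.1 hxz hzs⟩
      by_contra hsI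
      exact hwD ⟨s, ⟨hSD hs, hsI⟩, hwqo.2.1 hwz hzs⟩
    refine ⟨S ∩ I, Set.inter_subset_left, fun x hx y hy => ?_, ?_⟩
    · obtain ⟨z, hz, hxz, hyz⟩ := hI.2.2 x hx.2 y hy.2
      obtain ⟨s, hs, hzs⟩ := hcofinal z hz
      exact ⟨s, hs, hwqo.2.1 hxz hzs, hwqo.2.1 hyz hzs⟩
    · exact Set.Subset.antisymm (fun x ⟨s, hs, hxs⟩ => hI.2.1 hxs hs.2) hcofinal
  · rintro ⟨Δ, hΔS, -, rfl⟩ x ⟨s, hs, hxs⟩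
    exact ⟨s, hΔS hs, hxs⟩
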